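/- Let H be a separable complex Hilbert space and A a compact operator on H with the property that Trace(Aⁿ) exists and equals 0 for all integers n ≥ 2 (where A^n is trace class for n ≥ 2 since A is Hilbert–Schmidt). Then every eigenvalue of A is 0. -/

import Mathlib

open scoped InnerProductSpace

open Filter Topology ContinuousLinearMap

section HilbertSchmidt

variable {H : Type*} [NormedAddCommGroup H] [InnerProductSpace ℂ H] {ι : Type*}

theorem HilbertBasis.hasSum_norm_inner_sq (b : HilbertBasis ι ℂ H) (x : H) :
    HasSum (fun i => ‖⟪b i, x⟫_ℂ‖ ^ 2) (‖x‖ ^ 2) := by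
  have h := (b.hasSum_inner_mul_inner x x).mapL Complex.reCLM
  have hx : Complex.reCLM ⟪x, x⟫_ℂ = ‖x‖ ^ 2 := by
    rw [inner_self_eq_norm_sq_to_K]
    norm_cast
  rw [hx] at h
  refine h.congr_fun fun i => ?_
  rw [← inner_conj_symm x (b i), mul_comm, RCLike.mul_conj]
  norm_cast

variable [CompleteSpace H]

theorem HilbertBasis.summable_norm_adjoint_sq (b : HilbertBasis ι ℂ H) (A : H →L[ℂ] H)
    (hA : Summable fun i => ‖A (b i)‖ ^ 2) : Summable fun i => ‖adjoint A (b i)‖ ^ 2 := by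
  have h_prod : Summable fun p : ι × ι => ‖⟪b p.2, A (b p.1)⟫_ℂ‖ ^ 2 := by
    rw [summable_prod_of_nonneg fun p => by positivity]
    refine ⟨fun i => (b.hasSum_norm_inner_sq (A (b i))).summable, ?_⟩
    exact hA.congr fun i => ((b.hasSum_norm_inner_sq (A (b i))).tsum_eq).symm
  refine h_prod.prod_symm.prod.congr fun i => ?_
  rw [← (b.hasSum_norm_inner_sq (adjoint A (b i))).tsum_eq]
  refine tsum_congr fun j => ?_
  rw [adjoint_inner_right, norm_inner_symm]
  rfl

theorem HilbertBasis.exists_norm_trace_le (b : HilbertBasis ι ℂ H) (A : H →L[ℂ] H)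
    (hA : Summable fun i => ‖A (b i)‖ ^ 2) :
    ∃ C : ℝ, ∀ (n : ℕ) (t : ℂ), HasSum (fun i => ⟪b i, (A ^ (n + 2)) (b i)⟫_ℂ) t →
      ‖t‖ ≤ ‖A ^ n‖ * C := by
  have hA' := b.summable_norm_adjoint_sq A hA
  refine ⟨∑' i, (‖adjoint A (b i)‖ ^ 2 + ‖A (b i)‖ ^ 2), fun n t ht => ?_⟩
  rw [← ht.tsum_eq]
  refine tsum_of_norm_bounded ((hA'.add hA).hasSum.mul_left ‖A ^ n‖) fun i => ?_
  have h_pow : (A ^ (n + 2)) (b i) = A ((A ^ n) (A (b i))) := by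
    rw [pow_succ, pow_succ']
    rfl
  rw [h_pow, ← adjoint_inner_left]
  calc ‖⟪adjoint A (b i), (A ^ n) (A (b i))⟫_ℂ‖
      ≤ ‖adjoint A (b i)‖ * (‖A ^ n‖ * ‖A (b i)‖) :=
        (norm_inner_le_norm _ _).trans (by gcongr; exact le_opNorm _ _)
    _ = ‖A ^ n‖ * (‖adjoint A (b i)‖ * ‖A (b i)‖) := by ring
    _ ≤ _ := by
      gcongr
      nlinarith [two_mul_le_add_sq ‖adjoint A (b i)‖ ‖A (b i)‖,
        mul_nonneg (norm_nonneg (adjoint A (b i))) (norm_nonneg (A (b i)))]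

/-- Compressing to the orthogonal complement of an eigenvector removes one copy of the
eigenvalue from the power traces and lowers the squared Hilbert–Schmidt norm. -/
theorem HilbertBasis.exists_deflation (b : HilbertBasis ι ℂ H) {A : H →L[ℂ] H}
    (hA : IsCompactOperator A) {S : ℝ} (hS : HasSum (fun i => ‖A (b i)‖ ^ 2) S) {μ : ℂ}
    (hμ : Module.End.HasEigenvalue (A : H →ₗ[ℂ] H) μ) :
    ∃ (B : H →L[ℂ] H) (T : ℝ), IsCompactOperator B ∧ HasSum (fun i => ‖B (b i)‖ ^ 2) T ∧
      T ≤ S - ‖μ‖ ^ 2 ∧ ∀ n t, HasSum (fun i => ⟪b i, (A ^ (n + 1)) (b i)⟫_ℂ) t →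
        HasSum (fun i => ⟪b i, (B ^ (n + 1)) (b i)⟫_ℂ) (t - μ ^ (n + 1)) := by
  obtain ⟨v, hv, hv1⟩ : ∃ v : H, A v = μ • v ∧ ‖v‖ = 1 := by
    obtain ⟨w, hw⟩ := hμ.exists_hasEigenvector
    have hAw : A w = μ • w := hw.apply_eq_smul
    refine ⟨((‖w‖⁻¹ : ℝ) : ℂ) • w, by rw [map_smul, hAw, smul_comm], ?_⟩
    rw [norm_smul, Complex.norm_real, norm_inv, norm_norm,
      inv_mul_cancel₀ (norm_ne_zero_iff.2 hw.2)]
  have hvv : ⟪v, v⟫_ℂ = 1 := by rw [inner_self_eq_norm_sq_to_K, hv1]; simp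
  set Q : H →L[ℂ] H := 1 - (innerSL ℂ v).smulRight v with hQ
  have hQx (x : H) : Q x = x - ⟪v, x⟫_ℂ • v := by simp [hQ]
  have hBv : (Q ∘L A) v = 0 := by
    rw [comp_apply, hv, hQx, inner_smul_right, hvv, mul_one, sub_self]
  have h_succ (F : H →L[ℂ] H) (n : ℕ) (x : H) : (F ^ (n + 1)) x = F ((F ^ n) x) := by
    rw [pow_succ']
    rfl
  have h_pow (n : ℕ) (x : H) :
      ((Q ∘L A) ^ (n + 1)) x = (A ^ (n + 1)) x - ⟪v, (A ^ (n + 1)) x⟫_ℂ • v := by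
    induction n with
    | zero => simp [hQx]
    | succ n ih =>
      rw [h_succ, ih, map_sub, map_smul, hBv, smul_zero, sub_zero,
        h_succ A (n + 1), comp_apply, hQx]
  have hA_pow (n : ℕ) : (A ^ n) v = μ ^ n • v := by
    induction n with
    | zero => simp
    | succ n ih => rw [h_succ, ih, map_smul, hv, smul_smul, ← pow_succ]
  refine ⟨Q ∘L A, S - ‖adjoint A v‖ ^ 2, hA.clm_comp Q, ?_, ?_, fun n t ht => ?_⟩
  · refine (hS.sub (b.hasSum_norm_inner_sq (adjoint A v))).congr_fun fun i => ?_
    rw [adjoint_inner_right, norm_inner_symm, comp_apply, hQx]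
    have h_orth : ⟪A (b i) - ⟪v, A (b i)⟫_ℂ • v, ⟪v, A (b i)⟫_ℂ • v⟫_ℂ = 0 := by
      rw [inner_smul_right, inner_sub_left, inner_smul_left, hvv, inner_conj_symm]
      simp
    have h := norm_add_sq_eq_norm_sq_add_norm_sq_of_inner_eq_zero _ _ h_orth
    rw [sub_add_cancel, norm_smul, hv1, mul_one] at h
    nlinarith
  · have h : ‖μ‖ ≤ ‖adjoint A v‖ := by
      have h := norm_inner_le_norm (𝕜 := ℂ) (adjoint A v) v
      rwa [adjoint_inner_left, hv, inner_smul_right, hvv, mul_one, hv1, mul_one] at h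
    gcongr
  · have h := b.hasSum_inner_mul_inner (adjoint (A ^ (n + 1)) v) v
    rw [adjoint_inner_left, hA_pow, inner_smul_right, hvv, mul_one] at h
    refine (ht.sub h).congr_fun fun i => ?_
    rw [h_pow, inner_sub_right, inner_smul_right, adjoint_inner_left]

theorem HilbertBasis.exists_deflation_list (b : HilbertBasis ι ℂ H) {r : ℝ} (hr : 0 < r) (k : ℕ)
    {A : H →L[ℂ] H} (hA : IsCompactOperator A) {S : ℝ}
    (hS : HasSum (fun i => ‖A (b i)‖ ^ 2) S) (hk : S ≤ k * r ^ 2) :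
    ∃ (B : H →L[ℂ] H) (L : List ℂ), IsCompactOperator B ∧
      (Summable fun i => ‖B (b i)‖ ^ 2) ∧ (∀ z ∈ L, r ≤ ‖z‖) ∧
      (∀ μ, Module.End.HasEigenvalue (B : H →ₗ[ℂ] H) μ → ‖μ‖ < r) ∧
      ∀ n t, HasSum (fun i => ⟪b i, (A ^ (n + 1)) (b i)⟫_ℂ) t →
        HasSum (fun i => ⟪b i, (B ^ (n + 1)) (b i)⟫_ℂ)
          (t - (L.map (· ^ (n + 1))).sum) := by
  induction k generalizing A S with
  | zero =>
    refine ⟨A, [], hA, hS.summable, by simp, fun μ hμ => ?_, by simp⟩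
    by_contra! hμr
    obtain ⟨B, T, -, hT, hTS, -⟩ := b.exists_deflation hA hS hμ
    have hT0 : 0 ≤ T := hT.nonneg fun i => by positivity
    have hrμ : r ^ 2 ≤ ‖μ‖ ^ 2 := by gcongr
    norm_num at hk
    nlinarith [pow_pos hr 2]
  | succ k ih =>
    by_cases h : ∀ μ, Module.End.HasEigenvalue (A : H →ₗ[ℂ] H) μ → ‖μ‖ < r
    · exact ⟨A, [], hA, hS.summable, by simp, h, by simp⟩
    push Not at h
    obtain ⟨μ, hμ, hμr⟩ := h
    obtain ⟨B, T, hB, hT, hTS, hBtr⟩ := b.exists_deflation hA hS hμ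
    have hrμ : r ^ 2 ≤ ‖μ‖ ^ 2 := by gcongr
    obtain ⟨C, L, hC, hCS, hL, hCμ, hCtr⟩ := ih hB hT (by push_cast at hk; linarith)
    refine ⟨C, μ :: L, hC, hCS, by simpa using ⟨hμr, hL⟩, hCμ, fun n t ht => ?_⟩
    have := hCtr n _ (hBtr n t ht)
    rwa [sub_sub, ← List.sum_cons, ← List.map_cons (f := (· ^ (n + 1)))] at this

end HilbertSchmidt

/-- Simultaneous recurrence: finitely many unimodular numbers have powers close to `1`
simultaneously, with arbitrarily large exponent. -/
theorem exists_forall_norm_pow_sub_one_lt (s : Finset ℂ) (hs : ∀ z ∈ s, ‖z‖ = 1) {ε : ℝ}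
    (hε : 0 < ε) (N : ℕ) : ∃ n ≥ N, ∀ z ∈ s, ‖z ^ n - 1‖ < ε := by
  have h_mem (n : ℕ) : (fun z : s => (z : ℂ) ^ n) ∈
      Set.pi Set.univ fun _ : s => Metric.closedBall (0 : ℂ) 1 := by
    simp +contextual [Set.mem_pi, hs]
  obtain ⟨a, -, φ, hφ, ha⟩ :=
    (isCompact_univ_pi fun _ : s => isCompact_closedBall (0 : ℂ) 1).tendsto_subseq h_mem
  obtain ⟨M, hM⟩ := Metric.cauchySeq_iff.1 ha.cauchySeq ε hε
  have h_le : φ M + N ≤ φ (φ M + N + M) := by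
    have := hφ.id_le (φ M + N + M)
    simp only [id] at this
    lia
  refine ⟨φ (φ M + N + M) - φ M, by lia, fun z hz => ?_⟩
  have h := (dist_pi_lt_iff hε).1 (hM (φ M + N + M) (by lia) M le_rfl) ⟨z, hz⟩
  simp only [Function.comp_apply, dist_eq_norm] at h
  have h_eq : z ^ φ (φ M + N + M) - z ^ φ M =
      z ^ φ M * (z ^ (φ (φ M + N + M) - φ M) - 1) := by
    rw [mul_sub, ← pow_add, mul_one]
    congr 2
    lia
  rwa [h_eq, norm_mul, norm_pow, hs z hz, one_pow, one_mul] at h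

theorem exists_pow_le_two_mul_norm_sum_pow {r : ℝ} (hr : 0 < r) (L : List ℂ) (hL : L ≠ [])
    (hLr : ∀ z ∈ L, r ≤ ‖z‖) (N : ℕ) :
    ∃ n ≥ N, r ^ n ≤ 2 * ‖(L.map (· ^ n)).sum‖ := by
  obtain ⟨n, hn, h⟩ := exists_forall_norm_pow_sub_one_lt
    (L.toFinset.image fun z => z / (‖z‖ : ℂ)) (by
      simp only [Finset.mem_image, List.mem_toFinset]
      rintro _ ⟨z, hz, rfl⟩
      rw [norm_div, Complex.norm_real, norm_norm, div_self (hr.trans_le (hLr z hz)).ne'])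
    (one_half_pos (α := ℝ)) N
  refine ⟨n, hn, ?_⟩
  have h_re : ∀ z ∈ L, r ^ n / 2 ≤ (z ^ n).re := by
    intro z hz
    have hz0 : (‖z‖ : ℂ) ≠ 0 := by exact_mod_cast (hr.trans_le (hLr z hz)).ne'
    have h1 := h _ (Finset.mem_image_of_mem _ (List.mem_toFinset.2 hz))
    have h2 := (abs_lt.1 ((Complex.abs_re_le_norm _).trans_lt h1)).1
    rw [Complex.sub_re, Complex.one_re] at h2
    have h3 : z ^ n = ((‖z‖ ^ n : ℝ) : ℂ) * (z / (‖z‖ : ℂ)) ^ n := by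
      rw [Complex.ofReal_pow, ← mul_pow, mul_div_cancel₀ _ hz0]
    rw [h3, Complex.re_ofReal_mul]
    have h4 : r ^ n ≤ ‖z‖ ^ n := by
      gcongr
      exact hLr z hz
    nlinarith [pow_pos hr n]
  have h_nonneg : ∀ M : List ℂ, (∀ z ∈ M, r ^ n / 2 ≤ (z ^ n).re) →
      0 ≤ ((M.map (· ^ n)).sum).re := by
    intro M hM
    induction M with
    | nil => simp
    | cons z M ih =>
      simp only [List.mem_cons, forall_eq_or_imp] at hM
      simp only [List.map_cons, List.sum_cons, Complex.add_re]
      have := ih hM.2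
      have := pow_pos hr n
      linarith [hM.1]
  obtain ⟨z, M, rfl⟩ := List.exists_cons_of_ne_nil hL
  simp only [List.mem_cons, forall_eq_or_imp] at h_re
  have h1 := h_nonneg M h_re.2
  have h2 := Complex.re_le_norm ((z :: M).map (· ^ n)).sum
  simp only [List.map_cons, List.sum_cons, Complex.add_re] at h2 ⊢
  linarith [h_re.1]

theorem IsCompactOperator.exists_norm_pow_le {H : Type*} [NormedAddCommGroup H]
    [NormedSpace ℂ H] [CompleteSpace H] {B : H →L[ℂ] H} (hB : IsCompactOperator B) {r : ℝ}
    (hr : 0 < r) (h : ∀ μ, Module.End.HasEigenvalue (B : H →ₗ[ℂ] H) μ → ‖μ‖ < r) :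
    ∃ s, 0 ≤ s ∧ s < r ∧ ∀ᶠ n : ℕ in atTop, ‖B ^ n‖ ≤ s ^ n := by
  rcases subsingleton_or_nontrivial H with hH | hH
  · refine ⟨0, le_rfl, hr, Eventually.of_forall fun n => ?_⟩
    rw [Subsingleton.elim (B ^ n) 0, norm_zero]
    positivity
  lift r to NNReal using hr.le
  have h_rad : spectralRadius ℂ B < r := by
    refine spectrum.spectralRadius_lt_of_forall_lt B fun z hz => ?_
    rcases eq_or_ne z 0 with rfl | hz0
    · simpa using hr
    · exact h z ((hB.hasEigenvalue_iff_mem_spectrum hz0).2 hz)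
  obtain ⟨s, hs, hsr⟩ := ENNReal.lt_iff_exists_nnreal_btwn.1 h_rad
  refine ⟨s, s.2, by exact_mod_cast hsr, ?_⟩
  filter_upwards [(spectrum.pow_nnnorm_pow_one_div_tendsto_nhds_spectralRadius B).eventually_lt_const
    hs, eventually_gt_atTop 0] with n hn hn0
  rw [← ENNReal.coe_rpow_of_nonneg _ (by positivity), ENNReal.coe_lt_coe] at hn
  have h1 := pow_le_pow_left₀ zero_le hn.le n
  rw [one_div, NNReal.rpow_inv_natCast_pow _ hn0.ne'] at h1
  exact_mod_cast h1

/-- A compact, Hilbert–Schmidt operator `A` on a separable complex Hilbert space with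
`Trace(Aⁿ) = 0` for all `n ≥ 2` has no nonzero eigenvalue. -/
theorem stmt_11 {H : Type*} [NormedAddCommGroup H] [InnerProductSpace ℂ H]
    [CompleteSpace H] {ι : Type*} (b : HilbertBasis ι ℂ H) (A : H →L[ℂ] H)
    (hcompact : IsCompactOperator A)
    (hHS : Summable fun i => ‖A (b i)‖ ^ 2)
    (htr : ∀ n : ℕ, 2 ≤ n → HasSum (fun i => ⟪b i, (A ^ n) (b i)⟫_ℂ) (0 : ℂ)) :
    ∀ lam : ℂ, Module.End.HasEigenvalue (A : H →ₗ[ℂ] H) lam → lam = 0 := by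
  intro lam hlam
  by_contra hne
  have hr : 0 < ‖lam‖ := norm_pos_iff.2 hne
  obtain ⟨B, T, hB, hT, -, hBtr⟩ := b.exists_deflation hcompact hHS.hasSum hlam
  obtain ⟨k, hk⟩ := exists_nat_ge (T / ‖lam‖ ^ 2)
  obtain ⟨D, L, hD, hDS, hL, hDμ, hDtr⟩ :=
    b.exists_deflation_list hr k hB hT ((div_le_iff₀ (by positivity)).1 hk)
  obtain ⟨C, hC⟩ := b.exists_norm_trace_le D hDS
  obtain ⟨s, hs0, hsr, hs⟩ := hD.exists_norm_pow_le hr hDμ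
  have h_sum (n : ℕ) : ‖((lam :: L).map (· ^ (n + 2))).sum‖ ≤ ‖D ^ n‖ * C := by
    have h := hC n _ (hDtr (n + 1) _ (hBtr (n + 1) 0 (htr (n + 2) (by lia))))
    rwa [zero_sub, ← neg_add', norm_neg, ← List.sum_cons,
      ← List.map_cons (f := (· ^ (n + 1 + 1)))] at h
  have h_lim : Tendsto (fun n : ℕ => (s / ‖lam‖) ^ n * (2 * |C|)) atTop (𝓝 (0 * (2 * |C|))) :=
    (tendsto_pow_atTop_nhds_zero_of_lt_one (by positivity) ((div_lt_one hr).2 hsr)).mul_const _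
  rw [zero_mul] at h_lim
  obtain ⟨N, hN⟩ := eventually_atTop.1
    (hs.and (h_lim.eventually_lt_const (show 0 < ‖lam‖ ^ 2 by positivity)))
  obtain ⟨m, hm, h_low⟩ := exists_pow_le_two_mul_norm_sum_pow hr (lam :: L) (by simp)
    (by simpa using hL) (N + 2)
  obtain ⟨n, rfl⟩ := Nat.exists_eq_add_of_le' (show 2 ≤ m by lia)
  obtain ⟨h1, h2⟩ := hN n (by lia)
  have h3 : ‖lam‖ ^ (n + 2) ≤ s ^ n * (2 * |C|) :=
    calc ‖lam‖ ^ (n + 2) ≤ 2 * (‖D ^ n‖ * C) := h_low.trans (by gcongr; exact h_sum n)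
      _ ≤ 2 * (‖D ^ n‖ * |C|) := by
        gcongr
        exact le_abs_self C
      _ ≤ 2 * (s ^ n * |C|) := by gcongr
      _ = _ := by ring
  rw [div_pow, div_mul_eq_mul_div, div_lt_iff₀ (by positivity), ← pow_add, add_comm 2 n] at h2
  exact h3.not_gt h2
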